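/- On the positive-energy region, the scaled Laplace–Runge–Lenz components close into so(1,3)-type relations: at every point (q,p) with qʲ ≠ 0 and pⱼ ≠ 0 for all j and H_α(q,p) > 0, setting Γ⁺ᵢ = −Aᵅᵢ/√(2mH_α), one has {Γ⁺₁, Γ⁺₂}_α = −α²L′ᵅ₃, {Γ⁺₂, Γ⁺₃}_α = −α²L′ᵅ₁, {Γ⁺₃, Γ⁺₁}_α = −α²L′ᵅ₂, and {L′ᵅᵢ, Γ⁺ⱼ}_α = ε_{ijh}α²Γ⁺ₕ. Together with the relations among the L′ᵅᵢ this yields a Lie algebra isomorphic to so(1,3). -/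

import Mathlib

noncomputable section

/-- The conformable power helper `|x|^(α-1) * x`. -/
def confPow (α x : ℝ) : ℝ := |x| ^ (α - 1) * x

/-- Partial derivative of `f : (q,p) ↦ ℝ` with respect to the coordinate `qⁱ`. -/
def pdq (f : (Fin 3 → ℝ) → (Fin 3 → ℝ) → ℝ) (i : Fin 3) (q p : Fin 3 → ℝ) : ℝ :=
  deriv (fun t => f (Function.update q i t) p) (q i)

/-- Partial derivative of `f : (q,p) ↦ ℝ` with respect to the coordinate `pᵢ`. -/
def pdp (f : (Fin 3 → ℝ) → (Fin 3 → ℝ) → ℝ) (i : Fin 3) (q p : Fin 3 → ℝ) : ℝ :=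
  deriv (fun t => f q (Function.update p i t)) (p i)

/-- The conformable Poisson bracket
`{f,g}_α = Σᵢ α⁻² |pᵢ|^{1-α} |qⁱ|^{1-α} (∂f/∂pᵢ ∂g/∂qⁱ - ∂f/∂qⁱ ∂g/∂pᵢ)`. -/
def confPB (α : ℝ) (f g : (Fin 3 → ℝ) → (Fin 3 → ℝ) → ℝ) (q p : Fin 3 → ℝ) : ℝ :=
  ∑ i : Fin 3, (α ^ 2)⁻¹ * |p i| ^ (1 - α) * |q i| ^ (1 - α) *
    (pdp f i q p * pdq g i q p - pdq f i q p * pdp g i q p)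

/-- The conformable radius `r_α = √(Σᵢ (α|qⁱ|^{α-1}qⁱ)²)`. -/
def rConf (α : ℝ) (q : Fin 3 → ℝ) : ℝ :=
  Real.sqrt (∑ i : Fin 3, (α * confPow α (q i)) ^ 2)

/-- The conformable Kepler Hamiltonian
`H_α = Σᵢ (α|pᵢ|^{α-1}pᵢ)²/(2m) - k/r_α`. -/
def Hconf (α m k : ℝ) (q p : Fin 3 → ℝ) : ℝ :=
  (∑ i : Fin 3, (α * confPow α (p i)) ^ 2 / (2 * m)) - k / rConf α q

/-- The conformable angular momentum components (cyclic in the indices). -/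
def Lconf (α : ℝ) (i : Fin 3) (q p : Fin 3 → ℝ) : ℝ :=
  α ^ 2 * (confPow α (q (i + 1)) * confPow α (p (i + 2)) -
           confPow α (q (i + 2)) * confPow α (p (i + 1)))

/-- The conformable Laplace–Runge–Lenz vector components (cyclic in the indices). -/
def Aconf (α m k : ℝ) (i : Fin 3) (q p : Fin 3 → ℝ) : ℝ :=
  α * (confPow α (p (i + 1)) * Lconf α (i + 2) q p -
       confPow α (p (i + 2)) * Lconf α (i + 1) q p) -
  α * m * k / rConf α q * confPow α (q i)

/-- The scaled Laplace–Runge–Lenz vector on the negative-energy region: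
`Γᵢ = -Aᵅᵢ/√(-2mH_α)`. -/
def GammaNeg (α m k : ℝ) (i : Fin 3) (q p : Fin 3 → ℝ) : ℝ :=
  -Aconf α m k i q p / Real.sqrt (-(2 * m * Hconf α m k q p))

/-- The scaled Laplace–Runge–Lenz vector on the positive-energy region:
`Γ⁺ᵢ = -Aᵅᵢ/√(2mH_α)`. -/
def GammaPos (α m k : ℝ) (i : Fin 3) (q p : Fin 3 → ℝ) : ℝ :=
  -Aconf α m k i q p / Real.sqrt (2 * m * Hconf α m k q p)

/-- The Levi-Civita symbol `ε_{ijh} = (1/2)(i-j)(j-h)(h-i)`. -/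
def levicivita (i j h : Fin 3) : ℝ :=
  ((i.1 : ℝ) - (j.1 : ℝ)) * ((j.1 : ℝ) - (h.1 : ℝ)) * ((h.1 : ℝ) - (i.1 : ℝ)) / 2

/-- `F` has partial derivatives `a i` in the first and `b i` in the second argument at `(u, v)`. -/
def HasPartials (F : (Fin 3 → ℝ) → (Fin 3 → ℝ) → ℝ) (a b u v : Fin 3 → ℝ) : Prop :=
  ∀ i, HasDerivAt (fun t => F (Function.update u i t) v) (a i) (u i) ∧
    HasDerivAt (fun t => F u (Function.update v i t)) (b i) (v i)

namespace HasPartials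

variable {F G : (Fin 3 → ℝ) → (Fin 3 → ℝ) → ℝ} {a b a' b' u v : Fin 3 → ℝ}

lemma const (c : ℝ) (u v : Fin 3 → ℝ) : HasPartials (fun _ _ => c) 0 0 u v :=
  fun _ => ⟨hasDerivAt_const _ _, hasDerivAt_const _ _⟩

lemma hasDerivAt_update_apply (u : Fin 3 → ℝ) (i j : Fin 3) :
    HasDerivAt (fun t => Function.update u i t j) (Pi.single (M := fun _ => ℝ) j 1 i)
      (u i) :=
  (hasDerivAt_pi.1 (hasDerivAt_update u i (u i)) j).congr_deriv (Pi.single_comm i 1 j)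

lemma fst (j : Fin 3) (u v : Fin 3 → ℝ) :
    HasPartials (fun u _ => u j) (Pi.single j 1) 0 u v :=
  fun i => ⟨hasDerivAt_update_apply u i j, hasDerivAt_const _ _⟩

lemma snd (j : Fin 3) (u v : Fin 3 → ℝ) :
    HasPartials (fun _ v => v j) 0 (Pi.single j 1) u v :=
  fun i => ⟨hasDerivAt_const _ _, hasDerivAt_update_apply v i j⟩

lemma add (hF : HasPartials F a b u v) (hG : HasPartials G a' b' u v) :
    HasPartials (fun u v => F u v + G u v) (a + a') (b + b') u v :=
  fun i => ⟨(hF i).1.add (hG i).1, (hF i).2.add (hG i).2⟩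

lemma sub (hF : HasPartials F a b u v) (hG : HasPartials G a' b' u v) :
    HasPartials (fun u v => F u v - G u v) (a - a') (b - b') u v :=
  fun i => ⟨(hF i).1.sub (hG i).1, (hF i).2.sub (hG i).2⟩

lemma mul (hF : HasPartials F a b u v) (hG : HasPartials G a' b' u v) :
    HasPartials (fun u v => F u v * G u v) (G u v • a + F u v • a') (G u v • b + F u v • b')
      u v := by
  intro i
  constructor
  · refine ((hF i).1.mul (hG i).1).congr_deriv ?_
    simp [mul_comm]
  · refine ((hF i).2.mul (hG i).2).congr_deriv ?_
    simp [mul_comm]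

lemma comp {φ : ℝ → ℝ} {φ' : ℝ} (hF : HasPartials F a b u v)
    (hφ : HasDerivAt φ φ' (F u v)) :
    HasPartials (fun u v => φ (F u v)) (φ' • a) (φ' • b) u v := by
  intro i
  constructor
  · refine HasDerivAt.comp (u i) (h₂ := φ) ?_ (hF i).1
    simpa using hφ
  · refine HasDerivAt.comp (v i) (h₂ := φ) ?_ (hF i).2
    simpa using hφ

lemma congr (hF : HasPartials F a b u v) (ha : ∀ i, a i = a' i) (hb : ∀ i, b i = b' i) :
    HasPartials F a' b' u v := by
  rwa [← funext ha, ← funext hb]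

end HasPartials

/-- The canonical Poisson bracket of two functions with partial derivatives `a, b` and
`a', b'`, with the sign convention of `confPB`. -/
def gradBracket (a b a' b' : Fin 3 → ℝ) : ℝ := ∑ i, (b i * a' i - a i * b' i)

lemma hasDerivAt_confPow (α : ℝ) {x : ℝ} (hx : x ≠ 0) :
    HasDerivAt (confPow α) (α * |x| ^ (α - 1)) x := by
  have h := ((hasDerivAt_abs hx).rpow_const (p := α - 1) (Or.inl (abs_ne_zero.2 hx))).mul
    (hasDerivAt_id x)
  refine h.congr_deriv ?_
  have e : |x| ^ (α - 1) = |x| ^ (α - 1 - 1) * |x| := by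
    rw [← Real.rpow_add_one (abs_ne_zero.2 hx), sub_add_cancel]
  have hsign : (SignType.sign x : ℝ) * x = |x| := sign_mul_self x
  simp only [id]
  rw [e]
  linear_combination (α - 1) * |x| ^ (α - 1 - 1) * hsign

/-- The rescaled coordinates `α |qⁱ|^(α-1) qⁱ`, which are canonical up to the factor `α²`. -/
def confCoord (α : ℝ) (q : Fin 3 → ℝ) : Fin 3 → ℝ := fun i => α * confPow α (q i)

lemma confCoord_update (α : ℝ) (q : Fin 3 → ℝ) (i : Fin 3) (t : ℝ) :
    confCoord α (Function.update q i t)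
      = Function.update (confCoord α q) i (α * confPow α t) := by
  ext j
  rcases eq_or_ne j i with rfl | h <;> simp [confCoord, *]

lemma confPB_eq_gradBracket {α : ℝ} (hα : α ≠ 0) {q p : Fin 3 → ℝ}
    (hq : ∀ j, q j ≠ 0) (hp : ∀ j, p j ≠ 0)
    {F G : (Fin 3 → ℝ) → (Fin 3 → ℝ) → ℝ} {a b a' b' : Fin 3 → ℝ}
    (hF : HasPartials F a b (confCoord α q) (confCoord α p))
    (hG : HasPartials G a' b' (confCoord α q) (confCoord α p)) :
    confPB α (fun q p => F (confCoord α q) (confCoord α p))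
      (fun q p => G (confCoord α q) (confCoord α p)) q p
        = α ^ 2 * gradBracket a b a' b' := by
  have key : ∀ {F : (Fin 3 → ℝ) → (Fin 3 → ℝ) → ℝ} {a b : Fin 3 → ℝ},
      HasPartials F a b (confCoord α q) (confCoord α p) → ∀ i,
      pdq (fun q p => F (confCoord α q) (confCoord α p)) i q p
        = a i * (α * (α * |q i| ^ (α - 1))) ∧
      pdp (fun q p => F (confCoord α q) (confCoord α p)) i q p
        = b i * (α * (α * |p i| ^ (α - 1))) := by
    intro F a b h i
    constructor
    · simp only [pdq, confCoord_update]
      exact (HasDerivAt.comp (q i) (h := fun t => α * confPow α t) (h i).1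
        ((hasDerivAt_confPow α (hq i)).const_mul α)).deriv
    · simp only [pdp, confCoord_update]
      exact (HasDerivAt.comp (p i) (h := fun t => α * confPow α t) (h i).2
        ((hasDerivAt_confPow α (hp i)).const_mul α)).deriv
  have inv : ∀ x : ℝ, x ≠ 0 → |x| ^ (1 - α) * |x| ^ (α - 1) = 1 := by
    intro x hx
    rw [← Real.rpow_add (abs_pos.2 hx)]
    simp
  unfold confPB gradBracket
  rw [Finset.mul_sum]
  refine Finset.sum_congr rfl fun i _ => ?_
  rw [(key hF i).1, (key hF i).2, (key hG i).1, (key hG i).2]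
  have h1 := inv _ (hq i)
  have h2 := inv _ (hp i)
  have h3 : (α ^ 2)⁻¹ * α ^ 2 = 1 := inv_mul_cancel₀ (pow_ne_zero 2 hα)
  calc _ = ((α ^ 2)⁻¹ * α ^ 2) * α ^ 2 * (|q i| ^ (1 - α) * |q i| ^ (α - 1)) *
        (|p i| ^ (1 - α) * |p i| ^ (α - 1)) * (b i * a' i - a i * b' i) := by ring
    _ = _ := by rw [h1, h2, h3]; ring

/-- The reciprocal of the Euclidean norm. -/
def invRadius (u : Fin 3 → ℝ) : ℝ := (√(u 0 * u 0 + u 1 * u 1 + u 2 * u 2))⁻¹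

/-- Kepler angular momentum. -/
def keplerL (i : Fin 3) (u v : Fin 3 → ℝ) : ℝ := u (i + 1) * v (i + 2) - u (i + 2) * v (i + 1)

/-- Kepler Hamiltonian multiplied by `2m`, with `c = mk`. -/
def keplerH (c : ℝ) (u v : Fin 3 → ℝ) : ℝ :=
  v 0 * v 0 + v 1 * v 1 + v 2 * v 2 - 2 * c * invRadius u

/-- Kepler Laplace–Runge–Lenz vector, with `c = mk`. -/
def keplerA (c : ℝ) (i : Fin 3) (u v : Fin 3 → ℝ) : ℝ :=
  v (i + 1) * keplerL (i + 2) u v - v (i + 2) * keplerL (i + 1) u v - c * invRadius u * u i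

lemma invRadius_sq_mul {u : Fin 3 → ℝ} (hu : u ≠ 0) :
    invRadius u ^ 2 * (u 0 ^ 2 + u 1 ^ 2 + u 2 ^ 2) = 1 ∧
      0 < u 0 * u 0 + u 1 * u 1 + u 2 * u 2 := by
  have hpos : 0 < u 0 * u 0 + u 1 * u 1 + u 2 * u 2 := by
    obtain ⟨i, hi⟩ := Function.ne_iff.1 hu
    have hi' : 0 < u i * u i := mul_self_pos.2 hi
    have h0 := mul_self_nonneg (u 0)
    have h1 := mul_self_nonneg (u 1)
    have h2 := mul_self_nonneg (u 2)
    fin_cases i <;> simp only [Fin.zero_eta, Fin.mk_one, Fin.reduceFinMk] at hi' <;> linarith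
  refine ⟨?_, hpos⟩
  rw [invRadius, inv_pow, Real.sq_sqrt hpos.le]
  simp only [sq]
  exact inv_mul_cancel₀ hpos.ne'

lemma hasDerivAt_inv_sqrt {x : ℝ} (hx : 0 < x) :
    HasDerivAt (fun x => (√x)⁻¹) (-(√x)⁻¹ ^ 3 / 2) x := by
  refine ((Real.hasDerivAt_sqrt hx.ne').fun_inv (Real.sqrt_ne_zero'.2 hx)).congr_deriv ?_
  field_simp

lemma hasPartials_invRadius {u : Fin 3 → ℝ} (hu : u ≠ 0) (v : Fin 3 → ℝ) :
    HasPartials (fun u _ => invRadius u) (fun i => -invRadius u ^ 3 * u i) 0 u v := by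
  have h : ∀ j, _ := fun j => (HasPartials.fst j u v).mul (.fst j u v)
  refine (HasPartials.comp (((h 0).add (h 1)).add (h 2))
    (hasDerivAt_inv_sqrt (invRadius_sq_mul hu).2)).congr (fun i => ?_) fun i => ?_
  · fin_cases i <;> simp [invRadius] <;> ring
  · simp

lemma hasPartials_keplerL (i : Fin 3) (u v : Fin 3 → ℝ) :
    HasPartials (keplerL i)
      (v (i + 2) • Pi.single (i + 1) 1 - v (i + 1) • Pi.single (i + 2) 1)
      (u (i + 1) • Pi.single (i + 2) 1 - u (i + 2) • Pi.single (i + 1) 1) u v :=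
  (((HasPartials.fst (i + 1) u v).mul (.snd (i + 2) u v)).sub
    ((HasPartials.fst (i + 2) u v).mul (.snd (i + 1) u v))).congr
    (fun j => by simp) fun j => by simp

lemma hasPartials_keplerH (c : ℝ) {u : Fin 3 → ℝ} (hu : u ≠ 0) (v : Fin 3 → ℝ) :
    HasPartials (keplerH c) (fun i => 2 * c * invRadius u ^ 3 * u i) (fun i => 2 * v i) u v := by
  have h : ∀ j, _ := fun j => (HasPartials.snd j u v).mul (.snd j u v)
  refine ((((h 0).add (h 1)).add (h 2)).sub
    ((HasPartials.const (2 * c) u v).mul (hasPartials_invRadius hu v))).congr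
      (fun i => ?_) fun i => ?_
  · simp; ring
  · fin_cases i <;> simp <;> ring

section Brackets

variable {c : ℝ} {u v a b a' b' aH bH : Fin 3 → ℝ}

/-- The Kepler Laplace–Runge–Lenz vector scaled by `-1/√(2mH)`. -/
def keplerGamma (c : ℝ) (i : Fin 3) (u v : Fin 3 → ℝ) : ℝ :=
  keplerA c i u v * -(√(keplerH c u v))⁻¹

/-- Partial derivatives of `keplerGamma`, given those of `keplerA` and `keplerH`. -/
lemma hasPartials_keplerGamma {i : Fin 3} (hh : 0 < keplerH c u v)
    (hA : HasPartials (keplerA c i) a b u v) (hH : HasPartials (keplerH c) aH bH u v) :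
    HasPartials (keplerGamma c i)
      (-(√(keplerH c u v))⁻¹ • a + (keplerA c i u v * ((√(keplerH c u v))⁻¹ ^ 3 / 2)) • aH)
      (-(√(keplerH c u v))⁻¹ • b + (keplerA c i u v * ((√(keplerH c u v))⁻¹ ^ 3 / 2)) • bH)
      u v := by
  refine (hA.mul (hH.comp (hasDerivAt_inv_sqrt hh).neg)).congr (fun j => ?_) fun j => ?_ <;>
  · simp; ring

lemma gradBracket_add_smul_add_smul (s t t' : ℝ) (hA : gradBracket a b aH bH = 0)
    (hA' : gradBracket a' b' aH bH = 0) :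
    gradBracket (s • a + t • aH) (s • b + t • bH) (s • a' + t' • aH) (s • b' + t' • bH)
      = s ^ 2 * gradBracket a b a' b' := by
  simp only [gradBracket, Fin.sum_univ_three, Pi.add_apply, Pi.smul_apply, smul_eq_mul] at *
  linear_combination s * t' * hA - s * t * hA'

lemma gradBracket_add_smul_right (s t : ℝ) (h : gradBracket a b aH bH = 0) :
    gradBracket a b (s • a' + t • aH) (s • b' + t • bH) = s * gradBracket a b a' b' := by
  simp only [gradBracket, Fin.sum_univ_three, Pi.add_apply, Pi.smul_apply, smul_eq_mul] at *
  linear_combination t * h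

lemma gradBracket_neg_left : gradBracket (-a) (-b) a' b' = -gradBracket a b a' b' := by
  simp only [gradBracket, Fin.sum_univ_three, Pi.neg_apply]
  ring

end Brackets

/-- The gradient of `keplerA c i` in the positions. -/
def keplerAFst (c : ℝ) (i : Fin 3) (u v : Fin 3 → ℝ) : Fin 3 → ℝ := fun j =>
  (v 0 ^ 2 + v 1 ^ 2 + v 2 ^ 2 - c * invRadius u) * (Pi.single i 1 : Fin 3 → ℝ) j
    - v i * v j + c * invRadius u ^ 3 * u i * u j

/-- The gradient of `keplerA c i` in the momenta. -/
def keplerASnd (i : Fin 3) (u v : Fin 3 → ℝ) : Fin 3 → ℝ := fun j =>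
  2 * u i * v j - u j * v i
    - (u 0 * v 0 + u 1 * v 1 + u 2 * v 2) * (Pi.single i 1 : Fin 3 → ℝ) j

lemma hasPartials_keplerA (c : ℝ) (i : Fin 3) {u : Fin 3 → ℝ} (hu : u ≠ 0) (v : Fin 3 → ℝ) :
    HasPartials (keplerA c i)
      (keplerAFst c i u v) (keplerASnd i u v) u v := by
  refine ((((HasPartials.snd (i + 1) u v).mul (hasPartials_keplerL (i + 2) u v)).sub
    ((HasPartials.snd (i + 2) u v).mul (hasPartials_keplerL (i + 1) u v))).sub
    (((HasPartials.const c u v).mul (hasPartials_invRadius hu v)).mul (.fst i u v))).congr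
      (fun j => ?_) fun j => ?_
  all_goals
    fin_cases i <;> fin_cases j <;> simp [keplerL, keplerAFst, keplerASnd] <;> ring

lemma gradBracket_keplerA_keplerH (c : ℝ) (i : Fin 3) {u : Fin 3 → ℝ} (hu : u ≠ 0)
    (v : Fin 3 → ℝ) :
    gradBracket (keplerAFst c i u v) (keplerASnd i u v)
      (fun i => 2 * c * invRadius u ^ 3 * u i) (fun i => 2 * v i) = 0 := by
  have h := (invRadius_sq_mul hu).1
  simp only [gradBracket, Fin.sum_univ_three]
  fin_cases i <;> simp [keplerAFst, keplerASnd]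
  · linear_combination (-2 * c * invRadius u * v 0) * h
  · linear_combination (-2 * c * invRadius u * v 1) * h
  · linear_combination (-2 * c * invRadius u * v 2) * h

lemma gradBracket_keplerA (c : ℝ) (i : Fin 3) {u : Fin 3 → ℝ} (hu : u ≠ 0) (v : Fin 3 → ℝ) :
    gradBracket (keplerAFst c i u v) (keplerASnd i u v)
      (keplerAFst c (i + 1) u v) (keplerASnd (i + 1) u v)
      = keplerH c u v * keplerL (i + 2) u v := by
  have h := (invRadius_sq_mul hu).1
  simp only [gradBracket, Fin.sum_univ_three, keplerH]
  fin_cases i <;> simp [keplerL, keplerAFst, keplerASnd]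
  · linear_combination (c * invRadius u * (u 0 * v 1 - u 1 * v 0)) * h
  · linear_combination (c * invRadius u * (u 1 * v 2 - u 2 * v 1)) * h
  · linear_combination (c * invRadius u * (u 2 * v 0 - u 0 * v 2)) * h

lemma gradBracket_keplerL_keplerH (c : ℝ) (i : Fin 3) (u v : Fin 3 → ℝ) :
    gradBracket (v (i + 2) • Pi.single (i + 1) 1 - v (i + 1) • Pi.single (i + 2) 1)
      (u (i + 1) • Pi.single (i + 2) 1 - u (i + 2) • Pi.single (i + 1) 1)
      (fun i => 2 * c * invRadius u ^ 3 * u i) (fun i => 2 * v i) = 0 := by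
  simp only [gradBracket, Fin.sum_univ_three]
  fin_cases i <;> simp <;> ring

lemma gradBracket_keplerL_keplerA (c : ℝ) (i j : Fin 3) (u v : Fin 3 → ℝ) :
    gradBracket (v (i + 2) • Pi.single (i + 1) 1 - v (i + 1) • Pi.single (i + 2) 1)
      (u (i + 1) • Pi.single (i + 2) 1 - u (i + 2) • Pi.single (i + 1) 1)
      (keplerAFst c j u v) (keplerASnd j u v)
      = -∑ h, levicivita i j h * keplerA c h u v := by
  simp only [gradBracket, Fin.sum_univ_three, levicivita]
  fin_cases i <;> fin_cases j <;> simp [keplerA, keplerL, keplerAFst, keplerASnd] <;> ring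

lemma rConf_inv (α : ℝ) (q : Fin 3 → ℝ) : (rConf α q)⁻¹ = invRadius (confCoord α q) := by
  simp [rConf, invRadius, confCoord, Fin.sum_univ_three, sq]

lemma Lconf_eq (α : ℝ) (i : Fin 3) (q p : Fin 3 → ℝ) :
    Lconf α i q p = keplerL i (confCoord α q) (confCoord α p) := by
  simp only [Lconf, keplerL, confCoord]
  ring

lemma two_mul_Hconf {m : ℝ} (hm : m ≠ 0) (α k : ℝ) (q p : Fin 3 → ℝ) :
    2 * m * Hconf α m k q p = keplerH (m * k) (confCoord α q) (confCoord α p) := by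
  simp only [Hconf, keplerH, div_eq_mul_inv k, rConf_inv, Fin.sum_univ_three]
  simp only [confCoord]
  field_simp

lemma Aconf_eq (α m k : ℝ) (i : Fin 3) (q p : Fin 3 → ℝ) :
    Aconf α m k i q p = keplerA (m * k) i (confCoord α q) (confCoord α p) := by
  simp only [Aconf, keplerA, div_eq_mul_inv, rConf_inv, Lconf_eq]
  simp only [confCoord]
  ring

lemma GammaPos_eq {m : ℝ} (hm : m ≠ 0) (α k : ℝ) (i : Fin 3) :
    GammaPos α m k i
      = fun q p => keplerGamma (m * k) i (confCoord α q) (confCoord α p) := by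
  ext q p
  rw [GammaPos, keplerGamma, two_mul_Hconf hm, Aconf_eq, div_eq_mul_inv]
  ring

/-- on the positive-energy region the scaled LRL components
`Γ⁺ᵢ = -Aᵅᵢ/√(2mH_α)` close into `so(1,3)`-type relations:
`{Γ⁺₁,Γ⁺₂}_α = -α²L′ᵅ₃` (and cyclically), and
`{L′ᵅᵢ, Γ⁺ⱼ}_α = Σₕ ε_{ijh} α² Γ⁺ₕ`. -/
theorem confPB_GammaPos_so13
    (α m k : ℝ) (hα : 1 ≤ α) (hm : 0 < m)
    (q p : Fin 3 → ℝ) (hq : ∀ j, q j ≠ 0) (hp : ∀ j, p j ≠ 0)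
    (hH : 0 < Hconf α m k q p) :
    (confPB α (GammaPos α m k 0) (GammaPos α m k 1) q p
        = -(α ^ 2 * (-Lconf α 2 q p)) ∧
     confPB α (GammaPos α m k 1) (GammaPos α m k 2) q p
        = -(α ^ 2 * (-Lconf α 0 q p)) ∧
     confPB α (GammaPos α m k 2) (GammaPos α m k 0) q p
        = -(α ^ 2 * (-Lconf α 1 q p))) ∧
    (∀ i j : Fin 3,
      confPB α (fun q p => -Lconf α i q p) (GammaPos α m k j) q p
        = ∑ h : Fin 3, levicivita i j h * α ^ 2 * GammaPos α m k h q p) := by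
  have hα0 : α ≠ 0 := by positivity
  have hu : confCoord α q ≠ 0 := by
    refine Function.ne_iff.2 ⟨0, ?_⟩
    have := Real.rpow_pos_of_pos (abs_pos.2 (hq 0)) (α - 1)
    exact mul_ne_zero hα0 (mul_ne_zero this.ne' (hq 0))
  have hh : 0 < keplerH (m * k) (confCoord α q) (confCoord α p) := by
    rw [← two_mul_Hconf hm.ne']
    positivity
  have hs : (-(√(keplerH (m * k) (confCoord α q) (confCoord α p)))⁻¹) ^ 2
      * keplerH (m * k) (confCoord α q) (confCoord α p) = 1 := by
    rw [neg_sq, inv_pow, Real.sq_sqrt hh.le, inv_mul_cancel₀ hh.ne']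
  have hΓ := fun i => hasPartials_keplerGamma hh (hasPartials_keplerA (m * k) i hu _)
    (hasPartials_keplerH (m * k) hu _)
  have key : ∀ i, confPB α (GammaPos α m k i) (GammaPos α m k (i + 1)) q p
      = -(α ^ 2 * (-Lconf α (i + 2) q p)) := by
    intro i
    rw [GammaPos_eq hm.ne', GammaPos_eq hm.ne', Lconf_eq,
      confPB_eq_gradBracket hα0 hq hp (hΓ i) (hΓ (i + 1)),
      gradBracket_add_smul_add_smul _ _ _ (gradBracket_keplerA_keplerH _ _ hu _)
        (gradBracket_keplerA_keplerH _ _ hu _), gradBracket_keplerA _ _ hu]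
    linear_combination α ^ 2 * keplerL (i + 2) (confCoord α q) (confCoord α p) * hs
  refine ⟨⟨key 0, key 1, key 2⟩, fun i j => ?_⟩
  have hL := (HasPartials.const 0 (confCoord α q) (confCoord α p)).sub
    (hasPartials_keplerL i _ _)
  simp only [zero_sub] at hL
  simp only [GammaPos_eq hm.ne', Lconf_eq]
  rw [confPB_eq_gradBracket hα0 hq hp hL (hΓ j), gradBracket_neg_left,
    gradBracket_add_smul_right _ _ (gradBracket_keplerL_keplerH _ _ _ _),
    gradBracket_keplerL_keplerA]
  simp only [keplerGamma, Fin.sum_univ_three]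
  ring
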